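/- Every ultrafilter in E arises from φ: if A ⊆ E is an ultrafilter then there exists k ∈ \bar{ℕ}^ℓ such that A = {e ∈ E : φ(k)(e) = 1}. Equivalently, the set Ê_∞ of characters of E whose associated filters are ultrafilters is exactly the image {φ(k) : k ∈ \bar{ℕ}^ℓ}. -/

import Mathlib

open scoped BigOperators

noncomputable section

/-- The Hilbert space `H = ℓ²(ℕ^ℓ × ℤ)`. -/
abbrev H (ℓ : ℕ) : Type := lp (fun _ : (Fin ℓ → ℕ) × ℤ => ℂ) 2

/-- The standard basis vector `e_{(a,z)}` of `H`. -/
noncomputable def basisVec (ℓ : ℕ) (a : Fin ℓ → ℕ) (z : ℤ) : H ℓ :=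
  lp.single 2 (a, z) 1

/-- `IsBop ℓ B` says that for each `i : Fin (ℓ+1)`, `r : ℤ` and `m n : Fin ℓ → ℕ`,
`B i r m n` is the operator `B_{i+1}(r,m,n)` of the paper (paper index `i ∈ {1,…,ℓ+1}`
is `i-1 : Fin (ℓ+1)` here).  For `k : Fin ℓ` (paper index `k+1 ≤ ℓ`) :
`B k r m n e_{(a,z)} = e_{(a',z+Σ_{j≤k}(m_j−n_j))}` if `a_j = n_j` for `j < k` and
`a_k ≥ n_k` (where `a'_j = m_j` for `j < k`, `a'_k = a_k − n_k + m_k`, `a'_j = a_j`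
for `j > k`), and `= 0` otherwise; and
`B ℓ r m n e_{(a,z)} = e_{(m, z + r + Σ_j (m_j − n_j))}` if `a = n`, and `= 0` otherwise. -/
def IsBop (ℓ : ℕ)
    (B : Fin (ℓ + 1) → ℤ → (Fin ℓ → ℕ) → (Fin ℓ → ℕ) → (H ℓ →L[ℂ] H ℓ)) : Prop :=
  (∀ (k : Fin ℓ) (r : ℤ) (m n : Fin ℓ → ℕ) (a : Fin ℓ → ℕ) (z : ℤ),
      B k.castSucc r m n (basisVec ℓ a z) =
        if (∀ j : Fin ℓ, j < k → a j = n j) ∧ n k ≤ a k then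
          basisVec ℓ
            (fun j => if j < k then m j else if j = k then a k - n k + m k else a j)
            (z + ∑ j ∈ Finset.univ.filter (fun j : Fin ℓ => j ≤ k), ((m j : ℤ) - (n j : ℤ)))
        else 0) ∧
  (∀ (r : ℤ) (m n : Fin ℓ → ℕ) (a : Fin ℓ → ℕ) (z : ℤ),
      B (Fin.last ℓ) r m n (basisVec ℓ a z) =
        if a = n then basisVec ℓ m (z + r + ∑ j, ((m j : ℤ) - (n j : ℤ))) else 0)

/-- The set of projections `E = {0} ∪ {p_i(m)}`, where `p_i(m) = B_i(0,m,m)`. -/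
def Eset (ℓ : ℕ)
    (B : Fin (ℓ + 1) → ℤ → (Fin ℓ → ℕ) → (Fin ℓ → ℕ) → (H ℓ →L[ℂ] H ℓ)) :
    Set (H ℓ →L[ℂ] H ℓ) :=
  {0} ∪ {x | ∃ (i : Fin (ℓ + 1)) (m : Fin ℓ → ℕ), x = B i 0 m m}

/-- A filter in `E`: a nonempty subset `A ⊆ E` with `0 ∉ A`, closed under (operator)
multiplication, and upward closed in `E` for the usual (Loewner) order on operators. -/
def IsFilterIn (ℓ : ℕ)
    (B : Fin (ℓ + 1) → ℤ → (Fin ℓ → ℕ) → (Fin ℓ → ℕ) → (H ℓ →L[ℂ] H ℓ))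
    (A : Set (H ℓ →L[ℂ] H ℓ)) : Prop :=
  A.Nonempty ∧ A ⊆ Eset ℓ B ∧ (0 : H ℓ →L[ℂ] H ℓ) ∉ A ∧
    (∀ e ∈ A, ∀ f ∈ A, e * f ∈ A) ∧
    (∀ e ∈ A, ∀ f ∈ Eset ℓ B, e ≤ f → f ∈ A)

/-- An ultrafilter in `E`: a filter maximal under inclusion. -/
def IsUltrafilterIn (ℓ : ℕ)
    (B : Fin (ℓ + 1) → ℤ → (Fin ℓ → ℕ) → (Fin ℓ → ℕ) → (H ℓ →L[ℂ] H ℓ))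
    (A : Set (H ℓ →L[ℂ] H ℓ)) : Prop :=
  IsFilterIn ℓ B A ∧ ∀ A' : Set (H ℓ →L[ℂ] H ℓ), IsFilterIn ℓ B A' → A ⊆ A' → A' = A

/-- A character of `E`: a nonzero multiplicative map `E → {0,1}` (valued in `Bool`,
with `&&` as multiplication) vanishing at `0`. -/
def IsCharacter (ℓ : ℕ)
    (B : Fin (ℓ + 1) → ℤ → (Fin ℓ → ℕ) → (Fin ℓ → ℕ) → (H ℓ →L[ℂ] H ℓ))
    (x : {e : H ℓ →L[ℂ] H ℓ // e ∈ Eset ℓ B} → Bool) : Prop :=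
  (∃ e, x e = true) ∧
    (∀ (e f : {e : H ℓ →L[ℂ] H ℓ // e ∈ Eset ℓ B}) (h : e.val * f.val ∈ Eset ℓ B),
      x ⟨e.val * f.val, h⟩ = (x e && x f)) ∧
    (∀ h : (0 : H ℓ →L[ℂ] H ℓ) ∈ Eset ℓ B, x ⟨0, h⟩ = false)

/-- `LeastInf ℓ k r` says that `r` is the least nonnegative integer such that
`k_{r+1} = ∞` (paper indexing, with the convention `k_{ℓ+1} = ∞`).  In the 0-indexed
formulation: `r ≤ ℓ`, `k r = ∞` if `r < ℓ`, and `k j ≠ ∞` for all `j < r`. -/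
def LeastInf (ℓ : ℕ) (k : Fin ℓ → ℕ∞) (r : ℕ) : Prop :=
  r ≤ ℓ ∧ (∀ h : r < ℓ, k ⟨r, h⟩ = ⊤) ∧ ∀ j : Fin ℓ, (j : ℕ) < r → k j ≠ ⊤

/-- The support of the character `φ(k)`, `k ∈ ℕ̄^ℓ`: it contains `p_i(m)` (paper index
`i ≤ ℓ`) iff `π_{i−1}(m) = π_{i−1}(k)` and `m_i ≤ k_i`, and `p_{ℓ+1}(m)` iff `m = k`. -/
def phiSupp (ℓ : ℕ)
    (B : Fin (ℓ + 1) → ℤ → (Fin ℓ → ℕ) → (Fin ℓ → ℕ) → (H ℓ →L[ℂ] H ℓ))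
    (k : Fin ℓ → ℕ∞) : Set (H ℓ →L[ℂ] H ℓ) :=
  {x | (∃ (i : Fin ℓ) (m : Fin ℓ → ℕ), x = B i.castSucc 0 m m ∧
          (∀ j : Fin ℓ, j < i → (m j : ℕ∞) = k j) ∧ (m i : ℕ∞) ≤ k i) ∨
       (∃ m : Fin ℓ → ℕ, x = B (Fin.last ℓ) 0 m m ∧ ∀ j : Fin ℓ, (m j : ℕ∞) = k j)}

open Classical in
/-- The character `φ(k) : E → {0,1}` associated to `k ∈ ℕ̄^ℓ`. -/
noncomputable def phi (ℓ : ℕ)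
    (B : Fin (ℓ + 1) → ℤ → (Fin ℓ → ℕ) → (Fin ℓ → ℕ) → (H ℓ →L[ℂ] H ℓ))
    (k : Fin ℓ → ℕ∞) : {e : H ℓ →L[ℂ] H ℓ // e ∈ Eset ℓ B} → Bool :=
  fun e => decide (e.val ∈ phiSupp ℓ B k)

/-- The set of `a` with `p_i(m) e_{(a,z)} ≠ 0`. -/
def cylinder {ℓ : ℕ} (i : Fin (ℓ + 1)) (m : Fin ℓ → ℕ) : Set (Fin ℓ → ℕ) :=
  {a | ∀ j : Fin ℓ, (j.castSucc < i → a j = m j) ∧ (j.castSucc = i → m j ≤ a j)}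

/-- The condition on `(i, m)` under which `p_i(m)` belongs to the support of `φ(k)`. -/
def Compat {ℓ : ℕ} (k : Fin ℓ → ℕ∞) (i : Fin (ℓ + 1)) (m : Fin ℓ → ℕ) : Prop :=
  ∀ j : Fin ℓ, (j.castSucc < i → (m j : ℕ∞) = k j) ∧ (j.castSucc = i → (m j : ℕ∞) ≤ k j)

theorem mem_cylinder_self {ℓ : ℕ} (i : Fin (ℓ + 1)) (m : Fin ℓ → ℕ) : m ∈ cylinder i m :=
  fun _ => ⟨fun _ => rfl, fun _ => le_rfl⟩

theorem Compat.cylinder_subset_or {ℓ : ℕ} {k : Fin ℓ → ℕ∞} {i i' : Fin (ℓ + 1)}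
    {m m' : Fin ℓ → ℕ} (h : Compat k i m) (h' : Compat k i' m') :
    cylinder i m ⊆ cylinder i' m' ∨ cylinder i' m' ⊆ cylinder i m := by
  have of_lt : ∀ {i i' : Fin (ℓ + 1)} {m m' : Fin ℓ → ℕ}, Compat k i m → Compat k i' m' →
      i < i' → cylinder i' m' ⊆ cylinder i m := by
    intro i i' m m' h h' hlt a ha j
    refine ⟨fun hj => ?_, fun hj => ?_⟩
    · rw [(ha j).1 (hj.trans hlt)]
      exact_mod_cast ((h' j).1 (hj.trans hlt)).trans ((h j).1 hj).symm
    · rw [(ha j).1 (hj ▸ hlt)]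
      exact_mod_cast ((h j).2 hj).trans ((h' j).1 (hj ▸ hlt)).ge
  have of_le : ∀ {i : Fin (ℓ + 1)} {m m' : Fin ℓ → ℕ}, Compat k i m → Compat k i m' →
      (∀ j : Fin ℓ, j.castSucc = i → m j ≤ m' j) → cylinder i m' ⊆ cylinder i m := by
    intro i m m' h h' hle a ha j
    refine ⟨fun hj => ?_, fun hj => (hle j hj).trans ((ha j).2 hj)⟩
    rw [(ha j).1 hj]
    exact_mod_cast ((h' j).1 hj).trans ((h j).1 hj).symm
  rcases lt_trichotomy i i' with hlt | rfl | hlt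
  · exact .inr (of_lt h h' hlt)
  · by_cases hle : ∀ j : Fin ℓ, j.castSucc = i → m j ≤ m' j
    · exact .inr (of_le h h' hle)
    · push Not at hle
      obtain ⟨j, rfl, hj⟩ := hle
      refine .inl (of_le h' h fun t ht => ?_)
      rw [Fin.castSucc_injective ℓ ht]
      exact hj.le
  · exact .inl (of_lt h' h hlt)

theorem compat_of_forall_inter_nonempty {ℓ : ℕ} {k : Fin ℓ → ℕ∞} {i : Fin (ℓ + 1)}
    {m : Fin ℓ → ℕ}
    (h : ∀ i' m', Compat k i' m' → (cylinder i m ∩ cylinder i' m').Nonempty) :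
    Compat k i m := by
  intro j
  induction j using WellFoundedLT.induction with
  | ind j ih =>
  by_cases hji : j.castSucc ≤ i
  swap
  · exact ⟨fun hj => absurd hj.le hji, fun hj => absurd hj.le hji⟩
  have hlow : ∀ t < j, (m t : ℕ∞) = k t := fun t ht =>
    (ih t ht).1 ((Fin.castSucc_lt_castSucc_iff.2 ht).trans_le hji)
  rcases eq_or_ne (k j) ⊤ with hk | hk
  · refine ⟨fun hj => ?_, fun _ => hk ▸ le_top⟩
    obtain ⟨a, ha, ha'⟩ := h j.castSucc (Function.update m j (m j + 1)) (by
      intro t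
      refine ⟨fun ht => ?_, fun ht => ?_⟩
      · have ht : t < j := Fin.castSucc_lt_castSucc_iff.1 ht
        rw [Function.update_of_ne ht.ne]
        exact hlow t ht
      · rw [Fin.castSucc_injective ℓ ht, hk]
        exact le_top)
    have h1 := (ha j).1 hj
    have h2 := (ha' j).2 rfl
    rw [Function.update_self] at h2
    omega
  · obtain ⟨c, hc⟩ := ENat.ne_top_iff_exists.1 hk
    obtain ⟨a, ha, ha'⟩ := h j.succ (fun t => if t < j then m t else if t = j then c else 0) (by
      intro t
      refine ⟨fun ht => ?_, fun ht => ?_⟩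
      · rcases (Fin.castSucc_lt_succ_iff.1 ht).lt_or_eq with ht | rfl
        · simpa [ht] using hlow t ht
        · simpa using hc
      · have ht : j < t := by
          rw [← Fin.castSucc_lt_castSucc_iff, ht]
          exact Fin.castSucc_lt_succ
        simp [ht.not_gt, ht.ne'])
    have h2 := (ha' j).1 Fin.castSucc_lt_succ
    simp only [lt_irrefl, if_false, if_true] at h2
    rw [← hc, ← h2]
    exact ⟨fun hj => by rw [(ha j).1 hj], fun hj => by exact_mod_cast (ha j).2 hj⟩

/-- `x` is the diagonal projection onto the basis vectors `e_{(a,z)}` with `a ∈ S`. -/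
def IsDiagProj {ℓ : ℕ} (x : H ℓ →L[ℂ] H ℓ) (S : Set (Fin ℓ → ℕ)) : Prop :=
  (∀ a ∈ S, ∀ z, x (basisVec ℓ a z) = basisVec ℓ a z) ∧
    ∀ a ∉ S, ∀ z, x (basisVec ℓ a z) = 0

theorem basisVec_ne_zero {ℓ : ℕ} (a : Fin ℓ → ℕ) (z : ℤ) : basisVec ℓ a z ≠ 0 := by
  intro h
  have := congrArg (fun v : H ℓ => v (a, z)) h
  simp [basisVec] at this

theorem ext_basisVec {ℓ : ℕ} {x y : H ℓ →L[ℂ] H ℓ}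
    (h : ∀ a z, x (basisVec ℓ a z) = y (basisVec ℓ a z)) : x = y := by
  refine lp.ext_continuousLinearMap (by simp) fun p => ?_
  ext1
  simpa [basisVec] using h p.1 p.2

theorem IsDiagProj.ext {ℓ : ℕ} {x y : H ℓ →L[ℂ] H ℓ} {S : Set (Fin ℓ → ℕ)}
    (hx : IsDiagProj x S) (hy : IsDiagProj y S) : x = y :=
  ext_basisVec fun a z => by
    by_cases ha : a ∈ S
    · rw [hx.1 a ha, hy.1 a ha]
    · rw [hx.2 a ha, hy.2 a ha]

theorem IsDiagProj.mul {ℓ : ℕ} {x y : H ℓ →L[ℂ] H ℓ} {S T : Set (Fin ℓ → ℕ)}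
    (hx : IsDiagProj x S) (hy : IsDiagProj y T) : IsDiagProj (x * y) (S ∩ T) := by
  refine ⟨fun a ha z => ?_, fun a ha z => ?_⟩
  · rw [mul_apply_eq_comp, hy.1 a ha.2, hx.1 a ha.1]
  · rw [mul_apply_eq_comp]
    by_cases haT : a ∈ T
    · rw [hy.1 a haT, hx.2 a fun haS => ha ⟨haS, haT⟩]
    · rw [hy.2 a haT, map_zero]

theorem isDiagProj_zero {ℓ : ℕ} : IsDiagProj (0 : H ℓ →L[ℂ] H ℓ) ∅ :=
  ⟨fun _ ha => ha.elim, fun _ _ _ => rfl⟩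

theorem IsDiagProj.ne_zero_iff {ℓ : ℕ} {x : H ℓ →L[ℂ] H ℓ} {S : Set (Fin ℓ → ℕ)}
    (hx : IsDiagProj x S) : x ≠ 0 ↔ S.Nonempty := by
  refine ⟨fun h => ?_, ?_⟩
  · by_contra hS
    rw [Set.not_nonempty_iff_eq_empty] at hS
    subst hS
    exact h (hx.ext isDiagProj_zero)
  · rintro ⟨a, ha⟩ rfl
    exact basisVec_ne_zero a 0 (hx.1 a ha 0).symm

theorem IsDiagProj.subset_of_le {ℓ : ℕ} {x y : H ℓ →L[ℂ] H ℓ} {S T : Set (Fin ℓ → ℕ)}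
    (hx : IsDiagProj x S) (hy : IsDiagProj y T) (hxy : x ≤ y) : S ⊆ T := by
  intro a ha
  by_contra haT
  have h := ((ContinuousLinearMap.le_def x y).1 hxy).re_inner_nonneg_left (basisVec ℓ a 0)
  rw [sub_apply, hx.1 a ha, hy.2 a haT, zero_sub, inner_neg_left, map_neg,
    inner_self_eq_norm_sq] at h
  have := norm_pos_iff.2 (basisVec_ne_zero a 0)
  nlinarith

section

variable {ℓ : ℕ} {B : Fin (ℓ + 1) → ℤ → (Fin ℓ → ℕ) → (Fin ℓ → ℕ) → (H ℓ →L[ℂ] H ℓ)}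
  {k : Fin ℓ → ℕ∞} {e f : H ℓ →L[ℂ] H ℓ}

theorem IsBop.isDiagProj (hB : IsBop ℓ B) (i : Fin (ℓ + 1)) (m : Fin ℓ → ℕ) :
    IsDiagProj (B i 0 m m) (cylinder i m) := by
  induction i using Fin.lastCases with
  | last =>
    have hmem : ∀ a, a ∈ cylinder (Fin.last ℓ) m ↔ a = m := fun a =>
      ⟨fun ha => funext fun j => (ha j).1 j.castSucc_lt_last,
        fun ha => ha ▸ mem_cylinder_self _ _⟩
    refine ⟨fun a ha z => ?_, fun a ha z => ?_⟩ <;> rw [hmem] at ha <;> rw [hB.2]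
    · simp [ha]
    · rw [if_neg ha]
  | cast i =>
    have hmem : ∀ a, a ∈ cylinder i.castSucc m ↔ (∀ j < i, a j = m j) ∧ m i ≤ a i := by
      intro a
      refine ⟨fun ha => ⟨fun j hj => (ha j).1 (Fin.castSucc_lt_castSucc_iff.2 hj), (ha i).2 rfl⟩,
        fun ha j => ⟨fun hj => ha.1 j (Fin.castSucc_lt_castSucc_iff.1 hj), fun hj => ?_⟩⟩
      rw [Fin.castSucc_injective ℓ hj]
      exact ha.2
    refine ⟨fun a ha z => ?_, fun a ha z => ?_⟩ <;> rw [hmem] at ha <;> rw [hB.1]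
    · rw [if_pos ha]
      simp only [sub_self, Finset.sum_const_zero, add_zero]
      congr 1
      funext j
      split_ifs with h1 h2
      · exact (ha.1 j h1).symm
      · rw [h2, Nat.sub_add_cancel ha.2]
      · rfl
    · rw [if_neg ha]

theorem mem_phiSupp_iff :
    e ∈ phiSupp ℓ B k ↔ ∃ i m, e = B i 0 m m ∧ Compat k i m := by
  constructor
  · rintro (⟨i, m, rfl, h1, h2⟩ | ⟨m, rfl, h⟩)
    · refine ⟨_, m, rfl, fun j =>
        ⟨fun hj => h1 j (Fin.castSucc_lt_castSucc_iff.1 hj), fun hj => ?_⟩⟩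
      rw [Fin.castSucc_injective ℓ hj]
      exact h2
    · exact ⟨_, m, rfl, fun j => ⟨fun _ => h j, fun _ => (h j).le⟩⟩
  · rintro ⟨i, m, rfl, h⟩
    induction i using Fin.lastCases with
    | last => exact .inr ⟨m, rfl, fun j => (h j).1 j.castSucc_lt_last⟩
    | cast i =>
      exact .inl ⟨i, m, rfl, fun j hj => (h j).1 (Fin.castSucc_lt_castSucc_iff.2 hj), (h i).2 rfl⟩

theorem phiSupp_subset_Eset : phiSupp ℓ B k ⊆ Eset ℓ B := by
  intro e he
  obtain ⟨i, m, rfl, -⟩ := mem_phiSupp_iff.1 he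
  exact .inr ⟨i, m, rfl⟩

theorem phiSupp_nonempty (hℓ : 1 ≤ ℓ) : (phiSupp ℓ B k).Nonempty := by
  refine ⟨_, .inl ⟨⟨0, hℓ⟩, 0, rfl, fun j hj => ?_, by simp⟩⟩
  exact absurd (Fin.lt_def.1 hj) (Nat.not_lt_zero _)

theorem IsBop.exists_isDiagProj (hB : IsBop ℓ B) (he : e ∈ Eset ℓ B) : ∃ S, IsDiagProj e S := by
  rcases he with rfl | ⟨i, m, rfl⟩
  · exact ⟨∅, isDiagProj_zero⟩
  · exact ⟨_, hB.isDiagProj i m⟩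

theorem IsBop.mul_comm (hB : IsBop ℓ B) (he : e ∈ Eset ℓ B) (hf : f ∈ Eset ℓ B) :
    e * f = f * e := by
  obtain ⟨S, hS⟩ := hB.exists_isDiagProj he
  obtain ⟨T, hT⟩ := hB.exists_isDiagProj hf
  exact (hS.mul hT).ext (Set.inter_comm T S ▸ hT.mul hS)

theorem IsBop.mul_eq_left_of_le (hB : IsBop ℓ B) (he : e ∈ Eset ℓ B) (hf : f ∈ Eset ℓ B)
    (hef : e ≤ f) : e * f = e := by
  obtain ⟨S, hS⟩ := hB.exists_isDiagProj he
  obtain ⟨T, hT⟩ := hB.exists_isDiagProj hf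
  have h := hS.mul hT
  rw [Set.inter_eq_left.2 (hS.subset_of_le hT hef)] at h
  exact h.ext hS

theorem IsBop.ne_zero_of_mem_phiSupp (hB : IsBop ℓ B) (he : e ∈ phiSupp ℓ B k) : e ≠ 0 := by
  obtain ⟨i, m, rfl, -⟩ := mem_phiSupp_iff.1 he
  exact (hB.isDiagProj i m).ne_zero_iff.2 ⟨m, mem_cylinder_self i m⟩

theorem IsBop.mul_mem_phiSupp (hB : IsBop ℓ B) (he : e ∈ phiSupp ℓ B k)
    (hf : f ∈ phiSupp ℓ B k) : e * f ∈ phiSupp ℓ B k := by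
  obtain ⟨i, m, rfl, h⟩ := mem_phiSupp_iff.1 he
  obtain ⟨i', m', rfl, h'⟩ := mem_phiSupp_iff.1 hf
  have hmul := (hB.isDiagProj i m).mul (hB.isDiagProj i' m')
  rcases h.cylinder_subset_or h' with hs | hs
  · rw [Set.inter_eq_left.2 hs] at hmul
    rwa [hmul.ext (hB.isDiagProj i m)]
  · rw [Set.inter_eq_right.2 hs] at hmul
    rwa [hmul.ext (hB.isDiagProj i' m')]

theorem IsBop.mem_phiSupp_of_forall_mul_ne_zero (hB : IsBop ℓ B) (hℓ : 1 ≤ ℓ)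
    (he : e ∈ Eset ℓ B) (h : ∀ q ∈ phiSupp ℓ B k, e * q ≠ 0) : e ∈ phiSupp ℓ B k := by
  rcases he with rfl | ⟨i, m, rfl⟩
  · obtain ⟨q, hq⟩ := phiSupp_nonempty (B := B) (k := k) hℓ
    exact absurd (zero_mul q) (h q hq)
  · refine mem_phiSupp_iff.2 ⟨i, m, rfl, compat_of_forall_inter_nonempty fun i' m' h' => ?_⟩
    exact ((hB.isDiagProj i m).mul (hB.isDiagProj i' m')).ne_zero_iff.1
      (h _ (mem_phiSupp_iff.2 ⟨i', m', rfl, h'⟩))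

theorem IsBop.left_mem_phiSupp_of_mul_mem (hB : IsBop ℓ B) (hℓ : 1 ≤ ℓ) (he : e ∈ Eset ℓ B)
    (hf : f ∈ Eset ℓ B) (h : e * f ∈ phiSupp ℓ B k) : e ∈ phiSupp ℓ B k :=
  hB.mem_phiSupp_of_forall_mul_ne_zero hℓ he fun q hq h0 =>
    hB.ne_zero_of_mem_phiSupp (hB.mul_mem_phiSupp h hq) <| by
      rw [hB.mul_comm he hf, mul_assoc, h0, mul_zero]

theorem IsBop.mul_mem_phiSupp_iff (hB : IsBop ℓ B) (hℓ : 1 ≤ ℓ) (he : e ∈ Eset ℓ B)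
    (hf : f ∈ Eset ℓ B) :
    e * f ∈ phiSupp ℓ B k ↔ e ∈ phiSupp ℓ B k ∧ f ∈ phiSupp ℓ B k :=
  ⟨fun h => ⟨hB.left_mem_phiSupp_of_mul_mem hℓ he hf h,
    hB.left_mem_phiSupp_of_mul_mem hℓ hf he (hB.mul_comm he hf ▸ h)⟩,
    fun h => hB.mul_mem_phiSupp h.1 h.2⟩

theorem IsBop.isFilterIn_phiSupp (hB : IsBop ℓ B) (hℓ : 1 ≤ ℓ) (k : Fin ℓ → ℕ∞) :
    IsFilterIn ℓ B (phiSupp ℓ B k) := by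
  refine ⟨phiSupp_nonempty hℓ, phiSupp_subset_Eset, fun h => hB.ne_zero_of_mem_phiSupp h rfl,
    fun e he f hf => hB.mul_mem_phiSupp he hf, fun e he f hf hef => ?_⟩
  have heE := phiSupp_subset_Eset he
  rw [← hB.mul_eq_left_of_le heE hf hef] at he
  exact ((hB.mul_mem_phiSupp_iff hℓ heE hf).1 he).2

theorem IsBop.isUltrafilterIn_phiSupp (hB : IsBop ℓ B) (hℓ : 1 ≤ ℓ) (k : Fin ℓ → ℕ∞) :
    IsUltrafilterIn ℓ B (phiSupp ℓ B k) := by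
  refine ⟨hB.isFilterIn_phiSupp hℓ k, fun A hA hsub => Set.Subset.antisymm (fun e he => ?_) hsub⟩
  refine hB.mem_phiSupp_of_forall_mul_ne_zero hℓ (hA.2.1 he) fun q hq h0 => hA.2.2.1 ?_
  exact h0 ▸ hA.2.2.2.1 e he q (hsub hq)

theorem IsFilterIn.exists_subset_phiSupp (hB : IsBop ℓ B) {A : Set (H ℓ →L[ℂ] H ℓ)}
    (hA : IsFilterIn ℓ B A) : ∃ k, A ⊆ phiSupp ℓ B k := by
  refine ⟨fun j => ⨆ (i : Fin (ℓ + 1)) (m : Fin ℓ → ℕ) (_ : B i 0 m m ∈ A ∧ j.castSucc ≤ i),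
    (m j : ℕ∞), fun e he => ?_⟩
  rcases hA.2.1 he with rfl | ⟨i, m, rfl⟩
  · exact absurd he hA.2.2.1
  have hle : ∀ j : Fin ℓ, j.castSucc ≤ i → (m j : ℕ∞) ≤
      ⨆ (i : Fin (ℓ + 1)) (m : Fin ℓ → ℕ) (_ : B i 0 m m ∈ A ∧ j.castSucc ≤ i), (m j : ℕ∞) :=
    fun j hj => le_iSup_of_le i (le_iSup_of_le m (le_iSup_of_le ⟨he, hj⟩ le_rfl))
  refine mem_phiSupp_iff.2 ⟨i, m, rfl, fun j => ⟨fun hj => (hle j hj.le).antisymm ?_,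
    fun hj => hle j hj.le⟩⟩
  refine iSup_le fun i' => iSup_le fun m' => iSup_le fun h => ?_
  obtain ⟨a, ha, ha'⟩ := ((hB.isDiagProj i m).mul (hB.isDiagProj i' m')).ne_zero_iff.1
    fun h0 => hA.2.2.1 (h0 ▸ hA.2.2.2.1 _ he _ h.1)
  rw [← (ha j).1 hj]
  rcases h.2.lt_or_eq with hj' | hj'
  · rw [(ha' j).1 hj']
  · exact_mod_cast (ha' j).2 hj'

theorem IsUltrafilterIn.exists_eq_phiSupp (hB : IsBop ℓ B) (hℓ : 1 ≤ ℓ)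
    {A : Set (H ℓ →L[ℂ] H ℓ)} (hA : IsUltrafilterIn ℓ B A) : ∃ k, A = phiSupp ℓ B k :=
  (hA.1.exists_subset_phiSupp hB).imp fun k hk => (hA.2 _ (hB.isFilterIn_phiSupp hℓ k) hk).symm

theorem phi_eq_true_iff (e : {e : H ℓ →L[ℂ] H ℓ // e ∈ Eset ℓ B}) :
    phi ℓ B k e = true ↔ e.val ∈ phiSupp ℓ B k := by
  simp [phi]

theorem IsBop.isCharacter_phi (hB : IsBop ℓ B) (hℓ : 1 ≤ ℓ) (k : Fin ℓ → ℕ∞) :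
    IsCharacter ℓ B (phi ℓ B k) := by
  refine ⟨?_, fun e f h => ?_, fun h => ?_⟩
  · obtain ⟨q, hq⟩ := phiSupp_nonempty (B := B) (k := k) hℓ
    exact ⟨⟨q, phiSupp_subset_Eset hq⟩, (phi_eq_true_iff _).2 hq⟩
  · rw [Bool.eq_iff_iff, Bool.and_eq_true, phi_eq_true_iff, phi_eq_true_iff, phi_eq_true_iff]
    exact hB.mul_mem_phiSupp_iff hℓ e.2 f.2
  · rw [← Bool.not_eq_true, phi_eq_true_iff]
    exact fun h0 => hB.ne_zero_of_mem_phiSupp h0 rfl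

end

/-- Every ultrafilter in `E` arises from `φ`: if `A ⊆ E` is an ultrafilter then
`A = {e ∈ E : φ(k)(e) = 1} = E ∩ supp φ(k)` for some `k ∈ ℕ̄^ℓ`; equivalently, the
set `Ê_∞` of characters whose associated filters are ultrafilters is exactly the
image of `φ`. -/
theorem ultrafilters_are_phi (ℓ : ℕ) (hℓ : 1 ≤ ℓ)
    (B : Fin (ℓ + 1) → ℤ → (Fin ℓ → ℕ) → (Fin ℓ → ℕ) → (H ℓ →L[ℂ] H ℓ))
    (hB : IsBop ℓ B) :
    (∀ A : Set (H ℓ →L[ℂ] H ℓ), IsUltrafilterIn ℓ B A →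
        ∃ k : Fin ℓ → ℕ∞, A = Eset ℓ B ∩ phiSupp ℓ B k) ∧
    {x : {e : H ℓ →L[ℂ] H ℓ // e ∈ Eset ℓ B} → Bool |
        IsCharacter ℓ B x ∧
        IsUltrafilterIn ℓ B {e | ∃ h : e ∈ Eset ℓ B, x ⟨e, h⟩ = true}} =
      Set.range (phi ℓ B) := by
  refine ⟨fun A hA => ?_, Set.ext fun x => ⟨fun ⟨_, hx⟩ => ?_, ?_⟩⟩
  · obtain ⟨k, rfl⟩ := hA.exists_eq_phiSupp hB hℓ
    exact ⟨k, (Set.inter_eq_right.2 phiSupp_subset_Eset).symm⟩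
  · obtain ⟨k, hk⟩ := hx.exists_eq_phiSupp hB hℓ
    refine ⟨k, funext fun e => ?_⟩
    rw [Bool.eq_iff_iff, phi_eq_true_iff, ← hk]
    exact ⟨fun ⟨_, h⟩ => h, fun h => ⟨e.2, h⟩⟩
  · rintro ⟨k, rfl⟩
    refine ⟨hB.isCharacter_phi hℓ k, ?_⟩
    have hset : {e | ∃ h : e ∈ Eset ℓ B, phi ℓ B k ⟨e, h⟩ = true} = phiSupp ℓ B k :=
      Set.ext fun e => ⟨fun ⟨_, h⟩ => (phi_eq_true_iff _).1 h,
        fun h => ⟨phiSupp_subset_Eset h, (phi_eq_true_iff _).2 h⟩⟩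
    rw [hset]
    exact hB.isUltrafilterIn_phiSupp hℓ k
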